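/- Let C be a symmetric monoidal category, let M and N be dualizable objects, and let f : Q ⊗ M → N ⊗ P and g : K ⊗ N → M ⊗ L be morphisms. Then tr((g ⊗ id_P) ∘ (id_K ⊗ f)), the trace with respect to M of the composite K ⊗ Q ⊗ M → K ⊗ N ⊗ P → M ⊗ L ⊗ P, equals tr(s ∘ (f ⊗ id_L) ∘ (id_Q ⊗ g) ∘ s), the trace with respect to N of the corresponding composite Q ⊗ K ⊗ N → N ⊗ L ⊗ P (with s denoting the evident symmetry isomorphisms reordering the tensor factors). -/

import Mathlib

open CategoryTheory MonoidalCategory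

universe v u

variable {C : Type u} [Category.{v} C] [MonoidalCategory C] [SymmetricCategory C]

/-- `(Mᵛ, η, ε)` is a dual pair for `M`: the coevaluation `η : I ⟶ M ⊗ Mᵛ` and
evaluation `ε : Mᵛ ⊗ M ⟶ I` satisfy the triangle identities. -/
def IsDualPair (M Mv : C) (η : 𝟙_ C ⟶ M ⊗ Mv) (ε : Mv ⊗ M ⟶ 𝟙_ C) : Prop :=
  ((λ_ M).inv ≫ η ▷ M ≫ (α_ M Mv M).hom ≫ M ◁ ε ≫ (ρ_ M).hom = 𝟙 M) ∧
  ((ρ_ Mv).inv ≫ Mv ◁ η ≫ (α_ Mv M Mv).inv ≫ ε ▷ Mv ≫ (λ_ Mv).hom = 𝟙 Mv)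

/-- The twisted trace of `f : Q ⊗ M ⟶ M ⊗ P` with respect to the dual pair `(Mᵛ, η, ε)`:
`Q ⟶ Q ⊗ (M ⊗ Mᵛ) ⟶ (Q ⊗ M) ⊗ Mᵛ ⟶ (M ⊗ P) ⊗ Mᵛ ⟶ (Mᵛ ⊗ M) ⊗ P ⟶ P`. -/
def trTw (M Mv : C) (η : 𝟙_ C ⟶ M ⊗ Mv) (ε : Mv ⊗ M ⟶ 𝟙_ C) {Q P : C}
    (f : Q ⊗ M ⟶ M ⊗ P) : Q ⟶ P :=
  (ρ_ Q).inv ≫ Q ◁ η ≫ (α_ Q M Mv).inv ≫ f ▷ Mv ≫ (β_ (M ⊗ P) Mv).hom ≫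
    (α_ Mv M P).inv ≫ ε ▷ P ≫ (λ_ P).hom

/-- The trace of an endomorphism `f : M ⟶ M` of a dualizable object `M`:
`I ⟶ M ⊗ Mᵛ ⟶ M ⊗ Mᵛ ⟶ Mᵛ ⊗ M ⟶ I`. -/
def trEnd (M Mv : C) (η : 𝟙_ C ⟶ M ⊗ Mv) (ε : Mv ⊗ M ⟶ 𝟙_ C) (f : M ⟶ M) :
    𝟙_ C ⟶ 𝟙_ C :=
  η ≫ f ▷ Mv ≫ (β_ M Mv).hom ≫ ε

/-- Currying `g : K ⊗ N ⟶ X` along the coevaluation of `N`. -/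
def coevCurry {N Nv : C} (η : 𝟙_ C ⟶ N ⊗ Nv) {K X : C} (g : K ⊗ N ⟶ X) : K ⟶ X ⊗ Nv :=
  (ρ_ K).inv ≫ K ◁ η ≫ (α_ K N Nv).inv ≫ g ▷ Nv

theorem coevCurry_uncurry {D : Type u} [Category.{v} D] [MonoidalCategory D]
    {N Nv : D} {η : 𝟙_ D ⟶ N ⊗ Nv} {ε : Nv ⊗ N ⟶ 𝟙_ D}
    (h : IsDualPair N Nv η ε) {K X : D} (g : K ⊗ N ⟶ X) :
    coevCurry η g ▷ N ≫ (α_ X Nv N).hom ≫ X ◁ ε ≫ (ρ_ X).hom = g := by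
  calc
    _ = 𝟙 _ ⊗≫ K ◁ η ▷ N ⊗≫ (g ▷ (Nv ⊗ N) ≫ X ◁ ε) ⊗≫ 𝟙 _ := by
      dsimp only [coevCurry]; monoidal
    _ = K ◁ ((λ_ N).inv ≫ η ▷ N ≫ (α_ N Nv N).hom ≫ N ◁ ε ≫ (ρ_ N).hom) ≫ g := by
      rw [← whisker_exchange]; monoidal
    _ = g := by rw [h.1]; simp

/-- Evaluating the outer factors of `(M ⊗ (L ⊗ P)) ⊗ Mᵛ` against each other. -/
theorem braiding_outer_evaluation {M Mv L P : C} (ε : Mv ⊗ M ⟶ 𝟙_ C) :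
    (β_ (M ⊗ L ⊗ P) Mv).hom ⊗≫ ε ▷ (L ⊗ P) ⊗≫ 𝟙 (L ⊗ P) =
      𝟙 _ ⊗≫ (β_ (M ⊗ L) (P ⊗ Mv)).hom ⊗≫ P ◁ ε ▷ L ⊗≫ (β_ P L).hom := by
  have hW : P ◁ ((β_ (M ⊗ L) Mv).hom ⊗≫ ε ▷ L ⊗≫ 𝟙 L) ≫ (β_ P L).hom =
      (β_ P ((M ⊗ L) ⊗ Mv)).hom ≫ ((β_ (M ⊗ L) Mv).hom ⊗≫ ε ▷ L ⊗≫ 𝟙 L) ▷ P :=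
    BraidedCategory.braiding_naturality_right _ _
  have hassoc : (β_ (M ⊗ L ⊗ P) Mv).hom =
      (α_ M L P).inv ▷ Mv ≫ (β_ ((M ⊗ L) ⊗ P) Mv).hom ≫ Mv ◁ (α_ M L P).hom := by
    rw [← BraidedCategory.braiding_naturality_left, inv_hom_whiskerRight_assoc]
  symm
  calc
    _ = 𝟙 _ ⊗≫ (β_ (M ⊗ L) P).hom ▷ Mv ⊗≫
        (P ◁ ((β_ (M ⊗ L) Mv).hom ⊗≫ ε ▷ L ⊗≫ 𝟙 L) ≫ (β_ P L).hom) := by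
      rw [BraidedCategory.braiding_tensor_right_hom (M ⊗ L) P Mv]; monoidal
    _ = 𝟙 _ ⊗≫ ((β_ (M ⊗ L) P).hom ≫ (β_ P (M ⊗ L)).hom) ▷ Mv ⊗≫ (M ⊗ L) ◁ (β_ P Mv).hom ⊗≫
        ((β_ (M ⊗ L) Mv).hom ⊗≫ ε ▷ L ⊗≫ 𝟙 L) ▷ P := by
      rw [hW, BraidedCategory.braiding_tensor_right_hom P (M ⊗ L) Mv]; monoidal
    _ = _ := by
      rw [SymmetricCategory.symmetry, hassoc,
        BraidedCategory.braiding_tensor_left_hom (M ⊗ L) P Mv]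
      monoidal

/-- Sliding a strand `N` across a morphism `w`. -/
theorem braiding_slide {A B D P : C} (N : C) (w : A ⊗ D ⟶ B ⊗ P) :
    (β_ A N).hom ▷ D ≫ (α_ N A D).hom ≫ N ◁ w ≫ (α_ N B P).inv ≫ (β_ N B).hom ▷ P ≫
        (α_ B N P).hom =
      (α_ A N D).hom ≫ A ◁ (β_ N D).hom ≫ (α_ A D N).inv ≫ w ▷ N ≫ (α_ B P N).hom ≫
        B ◁ (β_ P N).hom := by
  have hw : N ◁ w = (β_ N (A ⊗ D)).hom ≫ w ▷ N ≫ (β_ (B ⊗ P) N).hom := by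
    rw [← BraidedCategory.braiding_naturality_right_assoc, SymmetricCategory.symmetry,
      Category.comp_id]
  calc
    _ = 𝟙 _ ⊗≫ ((β_ A N).hom ≫ (β_ N A).hom) ▷ D ⊗≫ A ◁ (β_ N D).hom ⊗≫ w ▷ N ⊗≫
        B ◁ (β_ P N).hom ⊗≫ ((β_ B N).hom ≫ (β_ N B).hom) ▷ P ⊗≫ 𝟙 _ := by
      rw [hw, BraidedCategory.braiding_tensor_right_hom N A D,
        BraidedCategory.braiding_tensor_left_hom B P N]
      monoidal
    _ = _ := by
      rw [SymmetricCategory.symmetry, SymmetricCategory.symmetry]; monoidal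

/-- The two ways of evaluating the factors `Nᵛ`, `N` and `M`, `Mᵛ` of
`((M ⊗ L) ⊗ Nᵛ) ⊗ ((N ⊗ P) ⊗ Mᵛ)` agree. -/
theorem evaluation_braiding_comm {M Mv N Nv L P : C} (εM : Mv ⊗ M ⟶ 𝟙_ C)
    (εN : Nv ⊗ N ⟶ 𝟙_ C) :
    (β_ ((M ⊗ L) ⊗ Nv) ((N ⊗ P) ⊗ Mv)).hom ⊗≫ (N ⊗ P) ◁ εM ▷ (L ⊗ Nv) ⊗≫
        (β_ (N ⊗ P) (L ⊗ Nv)).hom ⊗≫ L ◁ εN ▷ P ⊗≫ 𝟙 (L ⊗ P) =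
      𝟙 _ ⊗≫ (M ⊗ L) ◁ εN ▷ (P ⊗ Mv) ⊗≫ (β_ (M ⊗ L) (P ⊗ Mv)).hom ⊗≫ P ◁ εM ▷ L ⊗≫
        (β_ P L).hom := by
  let w : ((M ⊗ L) ⊗ Nv) ⊗ (P ⊗ Mv) ⟶ (L ⊗ Nv) ⊗ P :=
    (β_ ((M ⊗ L) ⊗ Nv) (P ⊗ Mv)).hom ⊗≫ P ◁ εM ▷ (L ⊗ Nv) ⊗≫ (β_ P (L ⊗ Nv)).hom
  let φ : (L ⊗ Nv) ⊗ N ⟶ L := 𝟙 _ ⊗≫ L ◁ εN ⊗≫ 𝟙 _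
  let ψ : ((M ⊗ L) ⊗ Nv) ⊗ N ⟶ M ⊗ L := 𝟙 _ ⊗≫ M ◁ φ
  have hassoc : (β_ ((M ⊗ L) ⊗ Nv) ((N ⊗ P) ⊗ Mv)).hom =
      ((M ⊗ L) ⊗ Nv) ◁ (α_ N P Mv).hom ≫ (β_ ((M ⊗ L) ⊗ Nv) (N ⊗ P ⊗ Mv)).hom ≫
        (α_ N P Mv).inv ▷ ((M ⊗ L) ⊗ Nv) := by
    rw [← BraidedCategory.braiding_naturality_right, whiskerLeft_hom_inv_assoc]
  have hψ : ψ ▷ (P ⊗ Mv) ≫ (β_ (M ⊗ L) (P ⊗ Mv)).hom =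
      (β_ (((M ⊗ L) ⊗ Nv) ⊗ N) (P ⊗ Mv)).hom ≫ (P ⊗ Mv) ◁ ψ :=
    BraidedCategory.braiding_naturality_left _ _
  have hφ : P ◁ φ ≫ (β_ P L).hom = (β_ P ((L ⊗ Nv) ⊗ N)).hom ≫ φ ▷ P :=
    BraidedCategory.braiding_naturality_right _ _
  have hε : εM ▷ ((L ⊗ Nv) ⊗ N) ≫ 𝟙_ C ◁ φ = (Mv ⊗ M) ◁ φ ≫ εM ▷ L :=
    (whisker_exchange _ _).symm
  calc
    _ = 𝟙 _ ⊗≫ ((β_ ((M ⊗ L) ⊗ Nv) N).hom ▷ (P ⊗ Mv) ≫ (α_ N ((M ⊗ L) ⊗ Nv) (P ⊗ Mv)).hom ≫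
        N ◁ w ≫ (α_ N (L ⊗ Nv) P).inv ≫ (β_ N (L ⊗ Nv)).hom ▷ P ≫
        (α_ (L ⊗ Nv) N P).hom) ⊗≫ φ ▷ P := by
      rw [hassoc, BraidedCategory.braiding_tensor_right_hom ((M ⊗ L) ⊗ Nv) N (P ⊗ Mv),
        BraidedCategory.braiding_tensor_left_hom N P (L ⊗ Nv)]
      dsimp only [w, φ]; monoidal
    _ = 𝟙 _ ⊗≫ (β_ (((M ⊗ L) ⊗ Nv) ⊗ N) (P ⊗ Mv)).hom ⊗≫ P ◁ εM ▷ ((L ⊗ Nv) ⊗ N) ⊗≫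
        ((β_ P ((L ⊗ Nv) ⊗ N)).hom ≫ φ ▷ P) := by
      rw [braiding_slide N w, BraidedCategory.braiding_tensor_left_hom ((M ⊗ L) ⊗ Nv) N (P ⊗ Mv),
        BraidedCategory.braiding_tensor_right_hom P (L ⊗ Nv) N]
      dsimp only [w]; monoidal
    _ = 𝟙 _ ⊗≫ (β_ (((M ⊗ L) ⊗ Nv) ⊗ N) (P ⊗ Mv)).hom ⊗≫
        P ◁ (εM ▷ ((L ⊗ Nv) ⊗ N) ≫ 𝟙_ C ◁ φ) ⊗≫ (β_ P L).hom := by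
      rw [← hφ]; monoidal
    _ = 𝟙 _ ⊗≫ ((β_ (((M ⊗ L) ⊗ Nv) ⊗ N) (P ⊗ Mv)).hom ≫ (P ⊗ Mv) ◁ ψ) ⊗≫
        P ◁ εM ▷ L ⊗≫ (β_ P L).hom := by
      rw [hε]; dsimp only [ψ]; monoidal
    _ = _ := by
      rw [← hψ]; dsimp only [ψ, φ]; monoidal

/-- The trace of a composite, expressed through the curried factors. -/
theorem trTw_comp {M Mv N Nv Q P K L : C}
    (ηM : 𝟙_ C ⟶ M ⊗ Mv) (εM : Mv ⊗ M ⟶ 𝟙_ C)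
    (ηN : 𝟙_ C ⟶ N ⊗ Nv) (εN : Nv ⊗ N ⟶ 𝟙_ C) (hN : IsDualPair N Nv ηN εN)
    (f : Q ⊗ M ⟶ N ⊗ P) (g : K ⊗ N ⟶ M ⊗ L) :
    trTw M Mv ηM εM
        ((α_ K Q M).hom ≫ K ◁ f ≫ (α_ K N P).inv ≫ g ▷ P ≫ (α_ M L P).hom) =
      K ◁ coevCurry ηM f ≫ coevCurry ηN g ▷ ((N ⊗ P) ⊗ Mv) ≫
        (𝟙 _ ⊗≫ (M ⊗ L) ◁ εN ▷ (P ⊗ Mv) ⊗≫ (β_ (M ⊗ L) (P ⊗ Mv)).hom ⊗≫ P ◁ εM ▷ L ⊗≫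
        (β_ P L).hom) := by
  calc
    _ = K ◁ coevCurry ηM f ⊗≫ g ▷ (P ⊗ Mv) ⊗≫
        ((β_ (M ⊗ L ⊗ P) Mv).hom ⊗≫ εM ▷ (L ⊗ P) ⊗≫ 𝟙 (L ⊗ P)) := by
      dsimp only [trTw, coevCurry]; monoidal
    _ = K ◁ coevCurry ηM f ⊗≫ (coevCurry ηN g ▷ N ≫ (α_ (M ⊗ L) Nv N).hom ≫
        (M ⊗ L) ◁ εN ≫ (ρ_ (M ⊗ L)).hom) ▷ (P ⊗ Mv) ⊗≫
        (β_ (M ⊗ L) (P ⊗ Mv)).hom ⊗≫ P ◁ εM ▷ L ⊗≫ (β_ P L).hom := by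
      rw [braiding_outer_evaluation, coevCurry_uncurry hN g]; monoidal
    _ = _ := by monoidal

theorem trTw_naturality {M Mv Q Q' P P' : C} (η : 𝟙_ C ⟶ M ⊗ Mv) (ε : Mv ⊗ M ⟶ 𝟙_ C)
    (q : Q' ⟶ Q) (f : Q ⊗ M ⟶ M ⊗ P) (p : P ⟶ P') :
    trTw M Mv η ε (q ▷ M ≫ f ≫ M ◁ p) = q ≫ trTw M Mv η ε f ≫ p := by
  have hp : (M ◁ p) ▷ Mv ≫ (β_ (M ⊗ P') Mv).hom = (β_ (M ⊗ P) Mv).hom ≫ Mv ◁ M ◁ p :=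
    BraidedCategory.braiding_naturality_left _ _
  calc
    _ = 𝟙 _ ⊗≫ (Q' ◁ η ≫ q ▷ (M ⊗ Mv)) ⊗≫ f ▷ Mv ⊗≫
        ((M ◁ p) ▷ Mv ≫ (β_ (M ⊗ P') Mv).hom) ⊗≫ ε ▷ P' ⊗≫ 𝟙 _ := by
      dsimp only [trTw]; monoidal
    _ = 𝟙 _ ⊗≫ q ▷ 𝟙_ C ⊗≫ Q ◁ η ⊗≫ f ▷ Mv ⊗≫ (β_ (M ⊗ P) Mv).hom ⊗≫
        ((Mv ⊗ M) ◁ p ≫ ε ▷ P') ⊗≫ 𝟙 _ := by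
      rw [hp, whisker_exchange]; monoidal
    _ = _ := by
      rw [whisker_exchange]; dsimp only [trTw]; monoidal

/-- Cyclicity of the twisted trace: for `f : Q ⊗ M ⟶ N ⊗ P` and `g : K ⊗ N ⟶ M ⊗ L`
with `M, N` dualizable,
`tr_M((g ⊗ id_P) ∘ (id_K ⊗ f)) = tr_N(s ∘ (f ⊗ id_L) ∘ (id_Q ⊗ g) ∘ s)`. -/
theorem twisted_trace_cyclic {M Mv N Nv Q P K L : C}
    (ηM : 𝟙_ C ⟶ M ⊗ Mv) (εM : Mv ⊗ M ⟶ 𝟙_ C) (hM : IsDualPair M Mv ηM εM)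
    (ηN : 𝟙_ C ⟶ N ⊗ Nv) (εN : Nv ⊗ N ⟶ 𝟙_ C) (hN : IsDualPair N Nv ηN εN)
    (f : Q ⊗ M ⟶ N ⊗ P) (g : K ⊗ N ⟶ M ⊗ L) :
    trTw M Mv ηM εM
        ((α_ K Q M).hom ≫ K ◁ f ≫ (α_ K N P).inv ≫ g ▷ P ≫ (α_ M L P).hom) =
      trTw N Nv ηN εN
        ((β_ K Q).hom ▷ N ≫ (α_ Q K N).hom ≫ Q ◁ g ≫ (α_ Q M L).inv ≫ f ▷ L ≫
          (α_ N P L).hom ≫ N ◁ (β_ P L).hom) := by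
  calc
    _ = coevCurry ηN g ▷ Q ≫ ((M ⊗ L) ⊗ Nv) ◁ coevCurry ηM f ≫
        ((β_ ((M ⊗ L) ⊗ Nv) ((N ⊗ P) ⊗ Mv)).hom ⊗≫ (N ⊗ P) ◁ εM ▷ (L ⊗ Nv) ⊗≫
        (β_ (N ⊗ P) (L ⊗ Nv)).hom ⊗≫ L ◁ εN ▷ P ⊗≫ 𝟙 (L ⊗ P)) := by
      rw [trTw_comp ηM εM ηN εN hN, whisker_exchange_assoc, evaluation_braiding_comm]
    _ = coevCurry ηN g ▷ Q ≫ ((M ⊗ L) ⊗ Nv) ◁ coevCurry ηM f ≫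
        (β_ ((M ⊗ L) ⊗ Nv) ((N ⊗ P) ⊗ Mv)).hom ≫ (𝟙 _ ⊗≫ (N ⊗ P) ◁ εM ▷ (L ⊗ Nv) ⊗≫
        (β_ (N ⊗ P) (L ⊗ Nv)).hom ⊗≫ L ◁ εN ▷ P ⊗≫ ((β_ L P).hom ≫ (β_ P L).hom)) := by
      rw [SymmetricCategory.symmetry]; monoidal
    _ = (β_ K Q).hom ≫ Q ◁ coevCurry ηN g ≫ coevCurry ηM f ▷ ((M ⊗ L) ⊗ Nv) ≫
        (𝟙 _ ⊗≫ (N ⊗ P) ◁ εM ▷ (L ⊗ Nv) ⊗≫ (β_ (N ⊗ P) (L ⊗ Nv)).hom ⊗≫ L ◁ εN ▷ P ⊗≫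
        ((β_ L P).hom ≫ (β_ P L).hom)) := by
      rw [BraidedCategory.braiding_naturality_right_assoc,
        BraidedCategory.braiding_naturality_left_assoc]
    _ = (β_ K Q).hom ≫ trTw N Nv ηN εN ((α_ Q K N).hom ≫ Q ◁ g ≫ (α_ Q M L).inv ≫ f ▷ L ≫
          (α_ N P L).hom) ≫ (β_ P L).hom := by
      rw [trTw_comp ηN εN ηM εM hM]; monoidal
    _ = _ := by
      rw [← trTw_naturality]; simp only [Category.assoc]
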